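/- arXiv:1710.03057 — 6 statements merged into one kernel-verified Lean document; each statement's English description precedes it below -/
import Mathlib

section
/- Let 2 < p < ∞ and let ℓ^p denote the real Banach space of p-summable real sequences. Every continuous linear functional ℓ on the Banach space L₂(ℓ^p;ℝ) of bounded bilinear forms on ℓ^p (with the operator norm) that vanishes on every elementary tensor f⊗g with f,g ∈ (ℓ^p)* is identically zero. Consequently there are no nonzero operational tangent vectors of second order on ℓ^p for 2 < p < ∞. -/
open scoped ENNReal

namespace NSO

variable {p : ℝ≥0∞} [Fact (1 ≤ p)]

lemma norm_disj (h0 : 0 < p.toReal) (n : ℕ) (x y : lp (fun _ : ℕ => ℝ) p)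
    (hx : ∀ i, n ≤ i → x i = 0) (hy : ∀ i, i < n → y i = 0) :
    ‖x + y‖ ^ p.toReal = ‖x‖ ^ p.toReal + ‖y‖ ^ p.toReal := by
  have h1 := lp.hasSum_norm h0 x
  have h2 := lp.hasSum_norm h0 y
  have h3 := lp.hasSum_norm h0 (x + y)
  refine h3.unique ?_
  convert h1.add h2 using 2 with i
  rcases lt_or_ge i n with h | h
  · simp [hy i h, Real.zero_rpow h0.ne']
  · simp [hx i h, Real.zero_rpow h0.ne']

noncomputable def ev (p : ℝ≥0∞) [Fact (1 ≤ p)] (i : ℕ) : lp (fun _ : ℕ => ℝ) p →L[ℝ] ℝ :=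
  LinearMap.mkContinuous
    { toFun := fun x => x i
      map_add' := fun x y => by simp
      map_smul' := fun c x => by simp } 1
    (fun x => by
      have : p ≠ 0 := (lt_of_lt_of_le one_pos (Fact.out : 1 ≤ p)).ne'
      rw [one_mul]; exact lp.norm_apply_le_norm this x i)

lemma ev_apply (i : ℕ) (x : lp (fun _ : ℕ => ℝ) p) : ev p i x = x i := rfl

noncomputable def P (p : ℝ≥0∞) [Fact (1 ≤ p)] (n : ℕ) :
    lp (fun _ : ℕ => ℝ) p →L[ℝ] lp (fun _ : ℕ => ℝ) p :=
  ∑ i ∈ Finset.range n, (ev p i).smulRight (lp.single p i (1 : ℝ))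

noncomputable def Q (p : ℝ≥0∞) [Fact (1 ≤ p)] (n : ℕ) :
    lp (fun _ : ℕ => ℝ) p →L[ℝ] lp (fun _ : ℕ => ℝ) p :=
  ContinuousLinearMap.id ℝ _ - P p n

lemma P_eq (n : ℕ) (x : lp (fun _ : ℕ => ℝ) p) :
    P p n x = ∑ i ∈ Finset.range n, x i • lp.single p i (1 : ℝ) := by
  simp [P, ev_apply]

lemma P_coord (n : ℕ) (x : lp (fun _ : ℕ => ℝ) p) (j : ℕ) :
    (P p n x) j = if j < n then x j else 0 := by
  rw [← ev_apply, P_eq, map_sum]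
  simp [ev_apply, lp.single_apply, Pi.single_apply]

lemma Q_coord (n : ℕ) (x : lp (fun _ : ℕ => ℝ) p) (j : ℕ) :
    (Q p n x) j = if j < n then 0 else x j := by
  have : (Q p n x) j = x j - (P p n x) j := by simp [Q]
  rw [this, P_coord]
  split_ifs <;> simp

lemma PQ (n : ℕ) (x : lp (fun _ : ℕ => ℝ) p) : P p n x + Q p n x = x := by simp [Q]

lemma norm_PQ (h0 : 0 < p.toReal) (n : ℕ) (x : lp (fun _ : ℕ => ℝ) p) :
    ‖P p n x‖ ^ p.toReal + ‖Q p n x‖ ^ p.toReal = ‖x‖ ^ p.toReal := by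
  rw [← norm_disj h0 n, PQ]
  · intro i hi; simp [P_coord, not_lt.2 hi]
  · intro i hi; simp [Q_coord, hi]

lemma norm_P (h0 : 0 < p.toReal) (n : ℕ) (x : lp (fun _ : ℕ => ℝ) p) : ‖P p n x‖ ≤ ‖x‖ := by
  rw [← Real.rpow_le_rpow_iff (norm_nonneg _) (norm_nonneg _) h0, ← norm_PQ h0 n x]
  have := Real.rpow_nonneg (norm_nonneg (Q p n x)) p.toReal
  linarith

lemma norm_Q (h0 : 0 < p.toReal) (n : ℕ) (x : lp (fun _ : ℕ => ℝ) p) : ‖Q p n x‖ ≤ ‖x‖ := by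
  rw [← Real.rpow_le_rpow_iff (norm_nonneg _) (norm_nonneg _) h0, ← norm_PQ h0 n x]
  have := Real.rpow_nonneg (norm_nonneg (P p n x)) p.toReal
  linarith

lemma P_tendsto (hp' : p < ∞) (x : lp (fun _ : ℕ => ℝ) p) :
    Filter.Tendsto (fun n => P p n x) Filter.atTop (nhds x) := by
  have h := (lp.hasSum_single hp'.ne x).tendsto_sum_nat
  convert h using 2 with n
  rw [P_eq]
  refine Finset.sum_congr rfl fun i _ => ?_
  rw [← lp.single_smul]
  simp

set_option maxSynthPendingDepth 3 in
lemma bil_tendsto {E : Type*} [NormedAddCommGroup E] [NormedSpace ℝ E]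
    (B : E →L[ℝ] E →L[ℝ] ℝ) {f g : ℕ → E} {a b : E}
    (hf : Filter.Tendsto f Filter.atTop (nhds a)) (hg : Filter.Tendsto g Filter.atTop (nhds b)) :
    Filter.Tendsto (fun n => B (f n) (g n)) Filter.atTop (nhds (B a b)) :=
  (B.continuous₂.tendsto (a, b)).comp (hf.prodMk_nhds hg)

lemma tail_small (hp : 2 < p) (hp' : p < ∞)
    (B : lp (fun _ : ℕ => ℝ) p →L[ℝ] lp (fun _ : ℕ => ℝ) p →L[ℝ] ℝ) (ε : ℝ) (hε : 0 < ε) :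
    ∃ n, ∀ x y, ‖x‖ ≤ 1 → ‖y‖ ≤ 1 → B (Q p n x) (Q p n y) ≤ ε := by
  by_contra! hcon
  have h2 : 2 < p.toReal := by
    have := (ENNReal.toReal_lt_toReal (by simp) hp'.ne).2 hp
    simpa using this
  have h0 : 0 < p.toReal := by linarith
  have key : ∀ K : ℕ, ∃ n, ∃ X Y : lp (fun _ : ℕ => ℝ) p,
      (∀ i, n ≤ i → X i = 0) ∧ (∀ i, n ≤ i → Y i = 0) ∧
      ‖X‖ ^ p.toReal ≤ K ∧ ‖Y‖ ^ p.toReal ≤ K ∧ K * ε ≤ B X Y := by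
    intro K
    induction K with
    | zero => exact ⟨0, 0, 0, by simp, by simp, by simp [Real.zero_rpow h0.ne'],
        by simp [Real.zero_rpow h0.ne'], by simp⟩
    | succ K ih =>
      obtain ⟨n, X, Y, hX, hY, hXn, hYn, hB⟩ := ih
      obtain ⟨x, y, hx, hy, hxy⟩ := hcon n
      have ht : Filter.Tendsto (fun N => B (P p N (Q p n x)) (P p N (Q p n y))) Filter.atTop
          (nhds (B (Q p n x) (Q p n y))) :=
        bil_tendsto B (P_tendsto hp' (Q p n x)) (P_tendsto hp' (Q p n y))
      obtain ⟨N, hN1, hN2⟩ := ((ht.eventually (lt_mem_nhds hxy)).and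
        (Filter.eventually_ge_atTop n)).exists
      set u := P p N (Q p n x) with hu
      set v := P p N (Q p n y) with hv
      have hun : ‖u‖ ≤ 1 := (norm_P h0 _ _).trans ((norm_Q h0 _ _).trans hx)
      have hvn : ‖v‖ ≤ 1 := (norm_P h0 _ _).trans ((norm_Q h0 _ _).trans hy)
      have hul : ∀ i, i < n → u i = 0 := fun i hi => by simp [hu, P_coord, Q_coord, hi]
      have hvl : ∀ i, i < n → v i = 0 := fun i hi => by simp [hv, P_coord, Q_coord, hi]
      have huh : ∀ i, N ≤ i → u i = 0 := fun i hi => by simp [hu, P_coord, not_lt.2 hi]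
      have hvh : ∀ i, N ≤ i → v i = 0 := fun i hi => by simp [hv, P_coord, not_lt.2 hi]
      clear_value u v
      have fin : ∀ u v : lp (fun _ : ℕ => ℝ) p, ‖u‖ ≤ 1 → ‖v‖ ≤ 1 →
          (∀ i, i < n → u i = 0) → (∀ i, i < n → v i = 0) →
          (∀ i, N ≤ i → u i = 0) → (∀ i, N ≤ i → v i = 0) → ε < B u v →
          0 ≤ B X v + B u Y → 
          ∃ n, ∃ X Y : lp (fun _ : ℕ => ℝ) p,
            (∀ i, n ≤ i → X i = 0) ∧ (∀ i, n ≤ i → Y i = 0) ∧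
            ‖X‖ ^ p.toReal ≤ (K + 1 : ℕ) ∧ ‖Y‖ ^ p.toReal ≤ (K + 1 : ℕ) ∧
            (K + 1 : ℕ) * ε ≤ B X Y := by
        intro u v hun hvn hul hvl huh hvh hb hc
        refine ⟨N, X + u, Y + v, ?_, ?_, ?_, ?_, ?_⟩
        · intro i hi; simp [hX i (hN2.trans hi), huh i hi]
        · intro i hi; simp [hY i (hN2.trans hi), hvh i hi]
        · rw [norm_disj h0 n X u hX hul]
          have := Real.rpow_le_one (norm_nonneg u) hun h0.le
          push_cast; linarith
        · rw [norm_disj h0 n Y v hY hvl]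
          have := Real.rpow_le_one (norm_nonneg v) hvn h0.le
          push_cast; linarith
        · simp only [map_add, _root_.add_apply]
          push_cast; linarith
      rcases le_total 0 (B X v + B u Y) with h | h
      · exact fin u v hun hvn hul hvl huh hvh hN1 h
      · refine fin (-u) (-v) (by simpa using hun) (by simpa using hvn)
          (fun i hi => by simp [hul i hi]) (fun i hi => by simp [hvl i hi])
          (fun i hi => by simp [huh i hi]) (fun i hi => by simp [hvh i hi])
          (by simpa using hN1) ?_
        simp only [map_neg, _root_.neg_apply]
        linarith
  have bound : ∀ K : ℕ, 0 < K → (K : ℝ) ^ (1 - 2 / p.toReal) ≤ ‖B‖ / ε := by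
    intro K hK
    have hK' : (0 : ℝ) < K := by exact_mod_cast hK
    obtain ⟨n, X, Y, -, -, hX, hY, hB⟩ := key K
    have a : ∀ Z : lp (fun _ : ℕ => ℝ) p, ‖Z‖ ^ p.toReal ≤ K → ‖Z‖ ≤ (K : ℝ) ^ (1 / p.toReal) := by
      intro Z hZ
      rw [← Real.rpow_le_rpow_iff (norm_nonneg _) (by positivity) h0, ← Real.rpow_mul hK'.le,
        one_div_mul_cancel h0.ne', Real.rpow_one]
      exact hZ
    have h3 : B X Y ≤ ‖B‖ * ‖X‖ * ‖Y‖ := (le_abs_self _).trans (B.le_opNorm₂ X Y)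
    have h4 : ‖B‖ * ‖X‖ * ‖Y‖ ≤ ‖B‖ * (K : ℝ) ^ (1 / p.toReal) * (K : ℝ) ^ (1 / p.toReal) := by
      gcongr
      · exact a X hX
      · exact a Y hY
    rw [mul_assoc _ ((K : ℝ) ^ _), ← Real.rpow_add hK', ← add_div, one_add_one_eq_two] at h4
    rw [Real.rpow_sub hK', Real.rpow_one, div_le_div_iff₀ (by positivity) hε]
    linarith
  have hpos : 0 < 1 - 2 / p.toReal := by
    rw [sub_pos, div_lt_one h0]; exact h2
  have hlim := (tendsto_rpow_atTop hpos).comp (tendsto_natCast_atTop_atTop (R := ℝ))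
  obtain ⟨K, hK1, hK2⟩ := ((hlim.eventually_gt_atTop (‖B‖ / ε)).and
    (Filter.eventually_gt_atTop 0)).exists
  exact absurd (bound K hK2) (not_le.2 hK1)

set_option maxSynthPendingDepth 3 in
lemma bd {E : Type*} [NormedAddCommGroup E] [NormedSpace ℝ E]
    (ℓ : (E →L[ℝ] E →L[ℝ] ℝ) →L[ℝ] ℝ) :
    ∃ C, 0 ≤ C ∧ ∀ B, ‖ℓ B‖ ≤ C * ‖B‖ :=
  ⟨‖ℓ‖, norm_nonneg _, ℓ.le_opNorm⟩

end NSO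

open NSO in
/-- For `2 < p < ∞`, every continuous linear functional on the space of bounded
bilinear forms on `ℓ^p` that vanishes on all elementary tensors `f ⊗ g` of
continuous linear functionals `f, g ∈ (ℓ^p)*` is identically zero.  Consequently
there are no nonzero second-order operational tangent vectors on `ℓ^p` for
`2 < p < ∞`. -/
theorem no_second_order_tangent_vectors_on_lp
    (p : ℝ≥0∞) [Fact (1 ≤ p)] (hp : 2 < p) (hp' : p < ∞)
    (ℓ : ((lp (fun _ : ℕ => ℝ) p) →L[ℝ] (lp (fun _ : ℕ => ℝ) p) →L[ℝ] ℝ) →L[ℝ] ℝ)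
    (hℓ : ∀ f g : (lp (fun _ : ℕ => ℝ) p) →L[ℝ] ℝ, ℓ (f.smulRight g) = 0) :
    ℓ = 0 := by
  ext B
  have heq : ∀ n, ℓ B = ℓ (B.bilinearComp (Q p n) (Q p n)) := by
    intro n
    have : B = B.bilinearComp (Q p n) (Q p n)
        + ∑ i ∈ Finset.range n, (ev p i).smulRight (B (lp.single p i (1 : ℝ)))
        + ∑ i ∈ Finset.range n,
          ((B.flip (lp.single p i (1 : ℝ))).comp (Q p n)).smulRight (ev p i) := by
      ext x y
      have e1 : B x y = B (Q p n x) (Q p n y) + B (P p n x) y + B (Q p n x) (P p n y) := by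
        conv_lhs => rw [← PQ n x]
        conv_lhs => rw [map_add, _root_.add_apply]
        conv_lhs => arg 2; rw [← PQ n y]
        rw [map_add]
        ring
      rw [e1, P_eq n x, P_eq n y]
      simp [ev_apply, mul_comm]
    conv_lhs => rw [this]
    simp [map_sum, hℓ]
  have hpt : 0 < p.toReal := ENNReal.toReal_pos (by rintro rfl; simp at hp) hp'.ne
  obtain ⟨C, hC0, hC⟩ := bd ℓ
  have hsmall : ∀ ε > 0, ‖ℓ B‖ ≤ C * ε := by
    intro ε hε
    obtain ⟨n, hn⟩ := tail_small hp hp' B ε hε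
    rw [heq n]
    refine (hC _).trans (mul_le_mul_of_nonneg_left ?_ hC0)
    have habs : ∀ x y, ‖x‖ ≤ 1 → ‖y‖ ≤ 1 → ‖B (Q p n x) (Q p n y)‖ ≤ ε := by
      intro x y hx hy
      rw [Real.norm_eq_abs, abs_le']
      refine ⟨hn x y hx hy, ?_⟩
      have := hn (-x) y (by simpa using hx) hy
      simpa using this
    refine ContinuousLinearMap.opNorm_le_of_unit_norm hε.le fun x hx => ?_
    refine ContinuousLinearMap.opNorm_le_of_unit_norm hε.le fun y hy => ?_
    simpa using habs x y hx.le hy.le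
  have : ‖ℓ B‖ ≤ 0 := by
    refine le_of_forall_pos_le_add fun δ hδ => ?_
    have hl : 0 < C + 1 := by positivity
    refine (hsmall (δ / (C + 1)) (by positivity)).trans ?_
    rw [zero_add, mul_div_assoc', div_le_iff₀ hl]
    nlinarith [hC0]
  simpa using this
end

section
/- Let 1 ≤ p ≤ 2 and let ℓ^p denote the real Banach space of p-summable real sequences. There exists a nonzero continuous linear functional ℓ on the Banach space L₂(ℓ^p;ℝ) of bounded bilinear forms on ℓ^p (with the operator norm) such that ℓ(f⊗g) = 0 for all f,g ∈ (ℓ^p)*. Consequently there exist nonzero operational tangent vectors of second order on ℓ^p for 1 ≤ p ≤ 2. -/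
open scoped ENNReal

open Filter Topology in
lemma aux_ulim (U : Ultrafilter ℕ) (a : ℕ → ℝ) (C : ℝ) (h : ∀ n, ‖a n‖ ≤ C) :
    ∃ x, ‖x‖ ≤ C ∧ Tendsto a U (𝓝 x) := by
  have hc : IsCompact (Metric.closedBall (0 : ℝ) C) := isCompact_closedBall 0 C
  obtain ⟨x, hx, hle⟩ := hc.ultrafilter_le_nhds (U.map a) (by
    rw [Filter.le_principal_iff]
    exact Filter.mem_map.2 (Filter.mem_of_superset Filter.univ_mem (by
      intro n _
      simpa using h n)))
  exact ⟨x, by simpa using hx, hle⟩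

open Filter Topology in
lemma aux_functional {E : Type*} [NormedAddCommGroup E] [NormedSpace ℝ E]
    (U : Ultrafilter ℕ) (e : ℕ → E) (he : ∀ n, ‖e n‖ ≤ 1) :
    ∃ L : (E →L[ℝ] E →L[ℝ] ℝ) →L[ℝ] ℝ, ∀ B : E →L[ℝ] E →L[ℝ] ℝ,
      ∀ (d s : ℝ) (t : ℕ → ℝ), Tendsto (fun n => B (e n) (e n)) U (𝓝 d) →
        (∀ n, Tendsto (fun m => B (e n) (e m)) U (𝓝 (t n))) → Tendsto t U (𝓝 s) →
        L B = d - s := by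
  have hb : ∀ (B : E →L[ℝ] E →L[ℝ] ℝ) n m, ‖B (e n) (e m)‖ ≤ ‖B‖ := by
    intro B n m
    calc ‖B (e n) (e m)‖ ≤ ‖B‖ * ‖e n‖ * ‖e m‖ := B.le_opNorm₂ _ _
      _ ≤ ‖B‖ * 1 * 1 := by gcongr <;> exact he _
      _ = ‖B‖ := by ring
  choose d hd1 hd using fun B : E →L[ℝ] E →L[ℝ] ℝ =>
    aux_ulim U (fun n => B (e n) (e n)) ‖B‖ (fun n => hb B n n)
  choose t ht1 ht using fun (B : E →L[ℝ] E →L[ℝ] ℝ) n =>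
    aux_ulim U (fun m => B (e n) (e m)) ‖B‖ (fun m => hb B n m)
  choose s hs1 hs using fun (B : E →L[ℝ] E →L[ℝ] ℝ) =>
    aux_ulim U (t B) ‖B‖ (ht1 B)
  have key : ∀ B : E →L[ℝ] E →L[ℝ] ℝ,
      ∀ (d' s' : ℝ) (t' : ℕ → ℝ), Tendsto (fun n => B (e n) (e n)) U (𝓝 d') →
        (∀ n, Tendsto (fun m => B (e n) (e m)) U (𝓝 (t' n))) → Tendsto t' U (𝓝 s') →
        d B - s B = d' - s' := by
    intro B d' s' t' h1 h2 h3
    have : t B = t' := funext fun n => tendsto_nhds_unique (ht B n) (h2 n)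
    rw [← this] at h3
    rw [tendsto_nhds_unique (hd B) h1, tendsto_nhds_unique (hs B) h3]
  refine ⟨LinearMap.mkContinuous
    { toFun := fun B => d B - s B
      map_add' := fun A B => ?_
      map_smul' := fun c B => ?_ } 2 ?_, key⟩
  · rw [key (A + B) (d A + d B) (s A + s B) (fun n => t A n + t B n)
      (by simpa using (hd A).add (hd B)) (fun n => by simpa using (ht A n).add (ht B n))
      ((hs A).add (hs B))]
    ring
  · rw [key (c • B) (c * d B) (c * s B) (fun n => c * t B n)
      (by simpa using (hd B).const_mul c) (fun n => by simpa using (ht B n).const_mul c)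
      ((hs B).const_mul c)]
    simp
    ring
  · intro B
    calc ‖d B - s B‖ ≤ ‖d B‖ + ‖s B‖ := norm_sub_le _ _
      _ ≤ 2 * ‖B‖ := by linarith [hd1 B, hs1 B]

open Filter Topology in
lemma aux_incl (p : ℝ≥0∞) [Fact (1 ≤ p)] (hp : p ≤ 2) :
    ∃ T : lp (fun _ : ℕ => ℝ) p →L[ℝ] lp (fun _ : ℕ => ℝ) 2, ∀ x n, T x n = x n := by
  refine ⟨ContinuousLinearMap.ofSeqClosedGraph
    (g := lp.linearMapOfLE ℝ (fun _ : ℕ => ℝ) hp) ?_, fun x n => rfl⟩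
  intro u x y hu hy
  ext n
  have h1 := ((lp.lipschitzWith_one_eval (E := fun _ : ℕ => ℝ) p n).continuous.tendsto x).comp hu
  have h2 := ((lp.lipschitzWith_one_eval (E := fun _ : ℕ => ℝ) 2 n).continuous.tendsto y).comp hy
  exact tendsto_nhds_unique h2 h1

/-- For `1 ≤ p ≤ 2` there exists a nonzero continuous linear functional on the
space of bounded bilinear forms on `ℓ^p` that vanishes on all elementary tensors
`f ⊗ g` of continuous linear functionals `f, g ∈ (ℓ^p)*`.  Consequently there
exist nonzero second-order operational tangent vectors on `ℓ^p` for
`1 ≤ p ≤ 2`. -/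
theorem exists_second_order_tangent_vector_on_lp
    (p : ℝ≥0∞) [Fact (1 ≤ p)] (hp : p ≤ 2) :
    ∃ ℓ : ((lp (fun _ : ℕ => ℝ) p) →L[ℝ] (lp (fun _ : ℕ => ℝ) p) →L[ℝ] ℝ) →L[ℝ] ℝ,
      ℓ ≠ 0 ∧ ∀ f g : (lp (fun _ : ℕ => ℝ) p) →L[ℝ] ℝ, ℓ (f.smulRight g) = 0 := by
  have hp0 : 0 < p := zero_lt_one.trans_le Fact.out
  let e : ℕ → lp (fun _ : ℕ => ℝ) p := fun n => lp.single p n (1 : ℝ)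
  have he : ∀ n, ‖e n‖ ≤ 1 := fun n => by
    simp [e, lp.norm_single (E := fun _ : ℕ => ℝ) hp0]
  let U : Ultrafilter ℕ := Filter.hyperfilter ℕ
  obtain ⟨L, hL⟩ := aux_functional U e he
  obtain ⟨T, hT⟩ := aux_incl p hp
  refine ⟨L, ?_, ?_⟩
  · intro h0
    let B : lp (fun _ : ℕ => ℝ) p →L[ℝ] lp (fun _ : ℕ => ℝ) p →L[ℝ] ℝ :=
      (innerSL ℝ).bilinearComp T T
    have hTe : ∀ n, T (e n) = lp.single 2 n (1 : ℝ) := by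
      intro n
      ext m
      rw [hT]
      rfl
    have hB : ∀ n m, B (e n) (e m) = if n = m then 1 else 0 := by
      intro n m
      have : B (e n) (e m) = inner ℝ (T (e n)) (T (e m)) := rfl
      rw [this, hTe, lp.inner_single_left, hT]
      simp [e, lp.single_apply, Pi.single_apply]
    have := hL B 1 0 (fun _ => 0) (by simp [hB]) (fun n => by
      simp only [hB]
      refine tendsto_const_nhds.congr' ?_
      have : ∀ᶠ m in (U : Filter ℕ), m ≠ n := by
        refine Filter.hyperfilter_le_cofinite ?_
        simp
      filter_upwards [this] with m hm
      simp [hm.symm]) tendsto_const_nhds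
    rw [h0] at this
    simp at this
  · intro f g
    have hbd : ∀ (f : lp (fun _ : ℕ => ℝ) p →L[ℝ] ℝ) n, ‖f (e n)‖ ≤ ‖f‖ := fun f n => by
      simpa using f.le_of_opNorm_le_of_le le_rfl (he n)
    obtain ⟨a, -, ha⟩ := aux_ulim U (fun n => f (e n)) _ (hbd f)
    obtain ⟨b, -, hb⟩ := aux_ulim U (fun n => g (e n)) _ (hbd g)
    rw [hL (f.smulRight g) (a * b) (a * b) (fun n => f (e n) * b)
      (by simpa using ha.mul hb) (fun n => by simpa using hb.const_mul (f (e n)))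
      (ha.mul_const b), sub_self]
end

section
/- (Pitt's theorem) Let 1 ≤ q < p < ∞. Every bounded linear operator T : ℓ^p → ℓ^q between the real sequence spaces ℓ^p and ℓ^q is compact. -/
open scoped ENNReal

namespace PittAux

open Filter Topology

abbrev L (p : ℝ≥0∞) := lp (fun _ : ℕ => ℝ) p

noncomputable def P (p : ℝ≥0∞) [Fact (1 ≤ p)] (n : ℕ) : L p →L[ℝ] L p :=
  ∑ i ∈ Finset.range n,
    (lp.singleContinuousLinearMap ℝ (fun _ : ℕ => ℝ) p i).comp (lp.evalCLM ℝ (fun _ : ℕ => ℝ) p i)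

variable {p : ℝ≥0∞} [Fact (1 ≤ p)]

lemma P_eq (n : ℕ) (f : L p) : P p n f = ∑ i ∈ Finset.range n, lp.single p i (f i) := by
  unfold P
  rw [sum_apply]
  rfl

lemma P_apply (n : ℕ) (f : L p) (j : ℕ) : P p n f j = if j < n then f j else 0 := by
  rw [P_eq, lp.coeFn_sum, Finset.sum_apply]
  simp only [lp.coeFn_single, Finset.sum_pi_single, Finset.mem_range]

lemma P_P (m n : ℕ) (f : L p) : P p m (P p n f) = P p (min m n) f := by
  apply lp.ext
  funext j
  simp only [P_apply, lt_min_iff]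
  split_ifs <;> first | rfl | (exfalso; tauto)

lemma pos_toReal (hp : p < ∞) : 0 < p.toReal :=
  ENNReal.toReal_pos (zero_lt_one.trans_le (Fact.out : 1 ≤ p)).ne' hp.ne

lemma norm_split (hp : p < ∞) (n : ℕ) (f : L p) :
    ‖f‖ ^ p.toReal = ‖P p n f‖ ^ p.toReal + ‖f - P p n f‖ ^ p.toReal := by
  have h0 := pos_toReal hp
  have h1 := lp.norm_compl_sum_single h0 f (Finset.range n)
  have h2 := lp.norm_sum_single h0 (fun i => f i) (Finset.range n)
  rw [P_eq]
  linarith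

lemma norm_P_le (hp : p < ∞) (n : ℕ) (f : L p) : ‖P p n f‖ ≤ ‖f‖ := by
  have h0 := pos_toReal hp
  rw [← Real.rpow_le_rpow_iff (norm_nonneg _) (norm_nonneg _) h0, norm_split hp n f]
  have := Real.rpow_nonneg (norm_nonneg (f - P p n f)) p.toReal
  linarith

lemma norm_sub_P_le (hp : p < ∞) (n : ℕ) (f : L p) : ‖f - P p n f‖ ≤ ‖f‖ := by
  have h0 := pos_toReal hp
  rw [← Real.rpow_le_rpow_iff (norm_nonneg _) (norm_nonneg _) h0, norm_split hp n f]
  have := Real.rpow_nonneg (norm_nonneg (P p n f)) p.toReal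
  linarith

lemma norm_add (hp : p < ∞) (n : ℕ) (f g : L p) (hf : P p n f = f) (hg : P p n g = 0) :
    ‖f + g‖ ^ p.toReal = ‖f‖ ^ p.toReal + ‖g‖ ^ p.toReal := by
  rw [norm_split hp n (f + g), map_add, hf, hg]
  simp

lemma tendsto_P (hp : p < ∞) (f : L p) : Tendsto (fun n => P p n f) atTop (𝓝 f) := by
  have := (lp.hasSum_single hp.ne f).tendsto_sum_nat
  simpa only [P_eq] using this

lemma gliding (hp : p < ∞) {F : Type*} [NormedAddCommGroup F] [NormedSpace ℝ F]
    (T : L p →L[ℝ] F) (q : ℝ) (hq : 0 < q) (hqp : q < p.toReal) (c : ℝ) (hc : 0 < c)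
    (H : ∀ m v, P p m v = v → ∃ x, P p m x = 0 ∧ ‖x‖ ≤ 1 ∧ ‖T v‖ ^ q + c < ‖T (v + x)‖ ^ q) :
    False := by
  have h0 := pos_toReal hp
  have key : ∀ N : ℕ, ∃ v m, P p m v = v ∧ ‖v‖ ^ p.toReal ≤ N ∧ N * c ≤ ‖T v‖ ^ q := by
    intro N
    induction N with
    | zero =>
      refine ⟨0, 0, by simp, ?_, ?_⟩
      · simp [Real.zero_rpow h0.ne']
      · simp [Real.zero_rpow hq.ne']
    | succ N ih =>
      obtain ⟨v, m, hv, hv1, hv2⟩ := ih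
      obtain ⟨x, hx, hx1, hx2⟩ := H m v hv
      have hcont : Tendsto (fun k => ‖T (v + P p k x)‖ ^ q) atTop (𝓝 (‖T (v + x)‖ ^ q)) := by
        have h1 : Tendsto (fun k => ‖T (v + P p k x)‖) atTop (𝓝 ‖T (v + x)‖) :=
          ((T.continuous.tendsto _).comp ((tendsto_P hp x).const_add v)).norm
        exact h1.rpow_const (Or.inr hq.le)
      obtain ⟨k, hk1, hk2⟩ := ((hcont.eventually (lt_mem_nhds hx2)).and (eventually_ge_atTop m)).exists
      have hz : P p m (P p k x) = 0 := by rw [P_P, min_eq_left hk2, hx]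
      refine ⟨v + P p k x, k, ?_, ?_, ?_⟩
      · rw [map_add, P_P, min_self]
        congr 1
        rw [← hv, P_P, min_eq_right hk2]
      · rw [norm_add hp m _ _ hv hz]
        have : ‖P p k x‖ ^ p.toReal ≤ 1 :=
          Real.rpow_le_one (norm_nonneg _) ((norm_P_le hp k x).trans hx1) h0.le
        push_cast
        linarith
      · push_cast
        linarith
  have hs : 0 < 1 - q / p.toReal := by
    rw [sub_pos, div_lt_one h0]; exact hqp
  have ht := (tendsto_rpow_atTop hs).comp (tendsto_natCast_atTop_atTop (R := ℝ))
  obtain ⟨N, hN1, hN2⟩ :=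
    ((ht.eventually_gt_atTop (‖T‖ ^ q / c)).and (eventually_ge_atTop 1)).exists
  obtain ⟨v, m, -, hv1, hv2⟩ := key N
  have hN : (0 : ℝ) < N := by exact_mod_cast hN2
  have hvN : ‖v‖ ^ q ≤ (N : ℝ) ^ (q / p.toReal) := by
    have : ‖v‖ ^ q = (‖v‖ ^ p.toReal) ^ (q / p.toReal) := by
      rw [← Real.rpow_mul (norm_nonneg _)]
      congr 1
      field_simp
    rw [this]
    exact Real.rpow_le_rpow (by positivity) hv1 (by positivity)
  have h3 : ‖T v‖ ^ q ≤ ‖T‖ ^ q * ‖v‖ ^ q := by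
    rw [← Real.mul_rpow (norm_nonneg _) (norm_nonneg _)]
    exact Real.rpow_le_rpow (norm_nonneg _) (T.le_opNorm v) hq.le
  have h4 : (N : ℝ) * c ≤ ‖T‖ ^ q * (N : ℝ) ^ (q / p.toReal) :=
    hv2.trans (h3.trans (mul_le_mul_of_nonneg_left hvN (by positivity)))
  simp only [Function.comp] at hN1
  rw [div_lt_iff₀ hc, Real.rpow_sub hN, Real.rpow_one] at hN1
  have hpos : 0 < (N : ℝ) ^ (q / p.toReal) := by positivity
  have h5 := mul_lt_mul_of_pos_right hN1 hpos
  have h6 : (N : ℝ) / (N : ℝ) ^ (q / p.toReal) * c * (N : ℝ) ^ (q / p.toReal) = N * c := by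
    field_simp
  linarith

lemma P_zero_mono {m n : ℕ} (h : m ≤ n) {x : L p} (hx : P p n x = 0) : P p m x = 0 := by
  rw [← min_eq_left h, ← P_P, hx, map_zero]

lemma functional (hp : p < ∞) (hp1 : 1 < p.toReal) (φ : L p →L[ℝ] ℝ) (ε : ℝ) (hε : 0 < ε) :
    ∀ᶠ n in atTop, ∀ x, P p n x = 0 → ‖x‖ ≤ 1 → |φ x| ≤ ε := by
  suffices h : ∃ n, ∀ x, P p n x = 0 → ‖x‖ ≤ 1 → |φ x| ≤ ε by
    obtain ⟨n, hn⟩ := h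
    filter_upwards [eventually_ge_atTop n] with k hk x hx
    exact hn x (P_zero_mono hk hx)
  by_contra! hcon
  refine gliding hp φ 1 one_pos hp1 ε hε ?_
  intro m v hv
  obtain ⟨x, hx, hx1, hx2⟩ := hcon m
  simp only [Real.rpow_one, Real.norm_eq_abs]
  rcases le_total 0 (φ v * φ x) with h | h
  · refine ⟨x, hx, hx1, ?_⟩
    rw [map_add, (abs_add_eq_add_abs_iff _ _).2 (mul_nonneg_iff.1 h)]
    linarith
  · refine ⟨-x, by simp [hx], by simpa using hx1, ?_⟩
    have h' : 0 ≤ φ v * (- φ x) := by linarith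
    rw [map_add, map_neg, (abs_add_eq_add_abs_iff _ _).2 (mul_nonneg_iff.1 h'), abs_neg]
    linarith

lemma norm_P_le_sum (n : ℕ) (f : L p) : ‖P p n f‖ ≤ ∑ i ∈ Finset.range n, |f i| := by
  rw [P_eq]
  refine (norm_sum_le _ _).trans (le_of_eq ?_)
  refine Finset.sum_congr rfl fun i _ => ?_
  rw [lp.norm_single (zero_lt_one.trans_le (Fact.out : 1 ≤ p)), Real.norm_eq_abs]

lemma exists_eps (a δ q : ℝ) (ha : 0 ≤ a) (hδ : 0 < δ) (hq : 0 < q) :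
    ∃ ε > 0, (a ^ q + (δ / 2) ^ q) ^ (1 / q) <
      ((max (a - ε) 0) ^ q + (max (δ - ε) 0) ^ q) ^ (1 / q) - 2 * ε := by
  have hcont : Continuous (fun ε : ℝ =>
      ((max (a - ε) 0) ^ q + (max (δ - ε) 0) ^ q) ^ (1 / q) - 2 * ε) := by
    refine Continuous.sub (Continuous.rpow_const (Continuous.add
      (Continuous.rpow_const (by fun_prop) fun _ => Or.inr hq.le)
      (Continuous.rpow_const (by fun_prop) fun _ => Or.inr hq.le))
      fun _ => Or.inr (by positivity)) (by fun_prop)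
  have h0 : (a ^ q + (δ / 2) ^ q) ^ (1 / q) <
      ((max (a - 0) 0) ^ q + (max (δ - 0) 0) ^ q) ^ (1 / q) - 2 * 0 := by
    rw [sub_zero, sub_zero, max_eq_left ha, max_eq_left hδ.le, mul_zero, sub_zero]
    refine Real.rpow_lt_rpow (by positivity) ?_ (by positivity)
    have := Real.rpow_lt_rpow (by positivity) (half_lt_self hδ) hq
    linarith
  have hev := (hcont.tendsto 0).eventually (lt_mem_nhds h0)
  have hev' : ∀ᶠ ε in 𝓝[>] (0 : ℝ), (a ^ q + (δ / 2) ^ q) ^ (1 / q) <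
      ((max (a - ε) 0) ^ q + (max (δ - ε) 0) ^ q) ^ (1 / q) - 2 * ε :=
    nhdsWithin_le_nhds hev
  obtain ⟨ε, h1, h2⟩ := (hev'.and self_mem_nhdsWithin).exists
  exact ⟨ε, h2, h1⟩

variable {q : ℝ≥0∞} [Fact (1 ≤ q)]

lemma tail (hqp : q < p) (hp : p < ∞) (T : L p →L[ℝ] L q) (δ : ℝ) (hδ : 0 < δ) :
    ∃ n, ∀ x, P p n x = 0 → ‖x‖ ≤ 1 → ‖T x‖ ≤ δ := by
  have hq := hqp.trans hp
  have hq0 := pos_toReal hq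
  have hqp' : q.toReal < p.toReal := (ENNReal.toReal_lt_toReal hq.ne hp.ne).2 hqp
  have hq1 : 1 ≤ q.toReal := by
    rw [← ENNReal.toReal_one]
    exact (ENNReal.toReal_le_toReal ENNReal.one_ne_top hq.ne).2 Fact.out
  have hp1 := hq1.trans_lt hqp'
  by_contra! hcon
  refine gliding hp T q.toReal hq0 hqp' ((δ / 2) ^ q.toReal) (by positivity) ?_
  intro m v hv
  set y := T v with hy
  obtain ⟨ε, hε, hlt⟩ := exists_eps ‖y‖ δ q.toReal (norm_nonneg _) hδ hq0
  obtain ⟨M, hM⟩ := ((tendsto_P hq y).eventually (Metric.ball_mem_nhds y hε)).exists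
  rw [dist_eq_norm] at hM
  have hev : ∀ᶠ n in atTop, ∀ j ∈ Finset.range M,
      ∀ x, P p n x = 0 → ‖x‖ ≤ 1 → |T x j| ≤ ε / (M + 1) := by
    rw [Filter.eventually_all_finset]
    intro j _
    exact functional hp hp1 ((lp.evalCLM ℝ (fun _ : ℕ => ℝ) q j).comp T) _ (by positivity)
  obtain ⟨n, hn1, hn2⟩ := (hev.and (eventually_ge_atTop m)).exists
  obtain ⟨x, hx, hx1, hx2⟩ := hcon n
  refine ⟨x, P_zero_mono hn2 hx, hx1, ?_⟩
  set z := T x with hz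
  have hPz : ‖P q M z‖ ≤ ε := by
    refine (norm_P_le_sum M z).trans ?_
    refine (Finset.sum_le_sum fun j hj => hn1 j hj x hx hx1).trans ?_
    rw [Finset.sum_const, Finset.card_range, nsmul_eq_mul, mul_div_assoc', div_le_iff₀ (by positivity)]
    nlinarith
  rw [map_add, ← hy, ← hz]
  have hsum := norm_add hq M (P q M y) (z - P q M z) (by rw [P_P, min_self])
    (by rw [map_sub, P_P, min_self, sub_self])
  have e1 : max (‖y‖ - ε) 0 ≤ ‖P q M y‖ := by
    refine max_le ?_ (norm_nonneg _)
    have := norm_sub_norm_le y (P q M y)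
    rw [norm_sub_rev] at this
    linarith
  have e2 : max (δ - ε) 0 ≤ ‖z - P q M z‖ := by
    refine max_le ?_ (norm_nonneg _)
    have := norm_sub_norm_le z (P q M z)
    linarith
  have e3 : ((max (‖y‖ - ε) 0) ^ q.toReal + (max (δ - ε) 0) ^ q.toReal) ^ (1 / q.toReal) ≤
      ‖P q M y + (z - P q M z)‖ := by
    have : ‖P q M y + (z - P q M z)‖ =
        (‖P q M y + (z - P q M z)‖ ^ q.toReal) ^ (1 / q.toReal) := by
      rw [one_div, Real.rpow_rpow_inv (norm_nonneg _) hq0.ne']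
    rw [this, hsum]
    refine Real.rpow_le_rpow (by positivity) (_root_.add_le_add ?_ ?_) (by positivity)
    · exact Real.rpow_le_rpow (le_max_right _ _) e1 hq0.le
    · exact Real.rpow_le_rpow (le_max_right _ _) e2 hq0.le
  have e4 : ‖P q M y + (z - P q M z)‖ ≤ ‖y + z‖ + 2 * ε := by
    have : P q M y + (z - P q M z) = (y + z) + ((P q M y - y) - P q M z) := by abel
    rw [this]
    have a1 := norm_add_le (y + z) ((P q M y - y) - P q M z)
    have a2 := norm_sub_le (P q M y - y) (P q M z)
    linarith
  have e5 : (‖y‖ ^ q.toReal + (δ / 2) ^ q.toReal) ^ (1 / q.toReal) < ‖y + z‖ := by linarith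
  have e6 := Real.rpow_lt_rpow (by positivity) e5 hq0
  rwa [one_div, Real.rpow_inv_rpow (by positivity) hq0.ne'] at e6

lemma compact_P (n : ℕ) : IsCompactOperator (P p n) := by
  have : P p n ∈ compactOperator (RingHom.id ℝ) (L p) (L p) := by
    unfold P
    refine Submodule.sum_mem _ fun i _ => ?_
    exact (isCompactOperator_of_locallyCompactSpace_dom
      (lp.evalCLM ℝ (fun _ : ℕ => ℝ) p i)).clm_comp
      (lp.singleContinuousLinearMap ℝ (fun _ : ℕ => ℝ) p i)
  exact this

end PittAux

open PittAux in
/-- Pitt's theorem: for `1 ≤ q < p < ∞`, every bounded linear operator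
`T : ℓ^p → ℓ^q` is compact. -/
theorem pitt_theorem
    (p q : ℝ≥0∞) [Fact (1 ≤ p)] [Fact (1 ≤ q)] (hqp : q < p) (hp : p < ∞)
    (T : lp (fun _ : ℕ => ℝ) p →L[ℝ] lp (fun _ : ℕ => ℝ) q) :
    IsCompactOperator T := by
  refine isCompactOperator_of_tendsto (l := Filter.atTop) (F := fun n => T.comp (P p n)) ?_
    (Filter.Eventually.of_forall fun n => (compact_P n).clm_comp T)
  rw [Metric.tendsto_atTop]
  intro ε hε
  obtain ⟨n, hn⟩ := tail hqp hp T (ε / 2) (half_pos hε)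
  refine ⟨n, fun k hk => ?_⟩
  rw [dist_comm, dist_eq_norm]
  refine lt_of_le_of_lt ?_ (half_lt_self hε)
  refine ContinuousLinearMap.opNorm_le_of_unit_norm (half_pos hε).le fun x hx => ?_
  have : (T - T.comp (P p k)) x = T (x - P p k x) := by
    rw [map_sub]; rfl
  rw [this]
  refine hn _ ?_ ((norm_sub_P_le hp k x).trans hx.le)
  rw [map_sub, P_P, min_eq_left hk, sub_self]
end

section
/- Let E be a real Banach space, a ∈ E, and let ℓ be a continuous linear functional on the Banach space L₂(E;ℝ) of bounded bilinear forms on E such that ℓ(f⊗g) = 0 for all f,g ∈ E*. Define δ_ℓ on smooth functions by δ_ℓ(f) := ℓ(f''_a), where f''_a ∈ L₂(E;ℝ) is the second Fréchet derivative of f at a. Then δ_ℓ is ℝ-linear and satisfies the Leibniz rule at a: δ_ℓ(fg) = δ_ℓ(f)·g(a) + f(a)·δ_ℓ(g) for all smooth f,g : E → ℝ; that is, δ_ℓ is an operational tangent vector at a. -/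
/-- Let `E` be a real Banach space, `a ∈ E`, and `ℓ` a continuous linear
functional on the bounded bilinear forms on `E` vanishing on all elementary
tensors `f ⊗ g`, `f, g ∈ E*`.  Then `δ_ℓ(f) := ℓ(f''_a)` (second Fréchet
derivative at `a`) is ℝ-linear on smooth functions and satisfies the Leibniz
rule at `a`; that is, `δ_ℓ` is an operational tangent vector at `a`. -/
theorem second_derivative_functional_is_operational_tangent_vector
    {E : Type*} [NormedAddCommGroup E] [NormedSpace ℝ E] [CompleteSpace E]
    (a : E) (ℓ : (E →L[ℝ] E →L[ℝ] ℝ) →L[ℝ] ℝ)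
    (hℓ : ∀ f g : E →L[ℝ] ℝ, ℓ (f.smulRight g) = 0) :
    -- ℝ-linearity of `f ↦ ℓ (f''_a)` on smooth functions
    (∀ f g : E → ℝ, ContDiff ℝ (⊤ : ℕ∞) f → ContDiff ℝ (⊤ : ℕ∞) g →
      ℓ (fderiv ℝ (fderiv ℝ (f + g)) a)
        = ℓ (fderiv ℝ (fderiv ℝ f) a) + ℓ (fderiv ℝ (fderiv ℝ g) a)) ∧
    (∀ (c : ℝ) (f : E → ℝ), ContDiff ℝ (⊤ : ℕ∞) f →
      ℓ (fderiv ℝ (fderiv ℝ (c • f)) a) = c * ℓ (fderiv ℝ (fderiv ℝ f) a)) ∧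
    -- Leibniz rule at `a`
    (∀ f g : E → ℝ, ContDiff ℝ (⊤ : ℕ∞) f → ContDiff ℝ (⊤ : ℕ∞) g →
      ℓ (fderiv ℝ (fderiv ℝ (f * g)) a)
        = ℓ (fderiv ℝ (fderiv ℝ f) a) * g a + f a * ℓ (fderiv ℝ (fderiv ℝ g) a)) := by
  have h1 : ∀ f : E → ℝ, ContDiff ℝ (⊤ : ℕ∞) f → Differentiable ℝ f := fun f hf =>
    hf.differentiable (by simp)
  have h2 : ∀ f : E → ℝ, ContDiff ℝ (⊤ : ℕ∞) f → Differentiable ℝ (fderiv ℝ f) := fun f hf =>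
    (hf.fderiv_right (m := 1) (WithTop.coe_le_coe.2 (le_top : (1 + 1 : ℕ∞) ≤ ⊤))).differentiable (by simp)
  refine ⟨fun f g hf hg => ?_, fun c f hf => ?_, fun f g hf hg => ?_⟩
  · have e : fderiv ℝ (f + g) = fderiv ℝ f + fderiv ℝ g := by
      funext x
      exact ((h1 f hf x).hasFDerivAt.add (h1 g hg x).hasFDerivAt).fderiv
    rw [e, ((h2 f hf a).hasFDerivAt.add (h2 g hg a).hasFDerivAt).fderiv, map_add]
  · have e : fderiv ℝ (c • f) = c • fderiv ℝ f := by
      funext x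
      exact ((h1 f hf x).hasFDerivAt.const_smul c).fderiv
    rw [e, ((h2 f hf a).hasFDerivAt.const_smul c).fderiv, map_smul, smul_eq_mul]
  · have e : fderiv ℝ (f * g) = f • fderiv ℝ g + g • fderiv ℝ f := by
      funext x
      exact ((h1 f hf x).hasFDerivAt.mul (h1 g hg x).hasFDerivAt).fderiv
    have k := (((h1 f hf a).hasFDerivAt.smul (h2 g hg a).hasFDerivAt).add
      ((h1 g hg a).hasFDerivAt.smul (h2 f hf a).hasFDerivAt)).fderiv
    rw [e, k]
    simp only [map_add, map_smul, hℓ, smul_eq_mul]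
    ring
end

section
/- Let H be an infinite-dimensional real Hilbert space and ℓ a continuous linear functional on B(H) with ℓ(𝟙) = 1 and ℓ(K) = 0 for every compact operator K. On M = H × ℝ define, for smooth f,g : H × ℝ → ℝ, {f,g}(v,x) := δ_ℓ(f(·,x))(v)·∂g/∂x(v,x) − ∂f/∂x(v,x)·δ_ℓ(g(·,x))(v), where δ_ℓ(h)(v) := ℓ(A_{h''_v}) for smooth h : H → ℝ and A_{h''_v} is the operator representing the second Fréchet derivative of h at v. Then there is no bounded bilinear functional Π on (H × ℝ)* × (H × ℝ)* such that {f,g}(0,0) = Π(Df(0,0), Dg(0,0)) for all smooth f,g : H × ℝ → ℝ; i.e., this Poisson bracket is queer at (0,0) and admits no Poisson tensor there. -/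
/-- The bounded operator `A` representing a bounded bilinear form `B` on a real
Hilbert space via `B(v,w) = ⟨A v, w⟩` (using the Riesz representation). -/
noncomputable def bilinToOp {H : Type*} [NormedAddCommGroup H] [InnerProductSpace ℝ H]
    [CompleteSpace H] (B : H →L[ℝ] H →L[ℝ] ℝ) : H →L[ℝ] H :=
  (InnerProductSpace.toDual ℝ H).symm.toContinuousLinearEquiv.toContinuousLinearMap.comp B

/-- The queer operational tangent vector `δ_ℓ(h)(v) := ℓ(A_{h''_v})` at `v`,
where `ℓ` is a functional on `B(H)` and `h : H → ℝ` is smooth. -/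
noncomputable def deltaEll {H : Type*} [NormedAddCommGroup H] [InnerProductSpace ℝ H]
    [CompleteSpace H] (ℓ : (H →L[ℝ] H) →L[ℝ] ℝ) (h : H → ℝ) (v : H) : ℝ :=
  ℓ (bilinToOp (fderiv ℝ (fderiv ℝ h) v))

/-- On `M = H × ℝ`, the bracket
`{f,g}(v,x) = δ_ℓ(f(·,x))(v)·∂g/∂x(v,x) − ∂f/∂x(v,x)·δ_ℓ(g(·,x))(v)`
built from a functional `ℓ` on `B(H)` with `ℓ(𝟙) = 1` vanishing on compact
operators is queer at `(0,0)`: no bounded bilinear functional `P` on the dual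
of `H × ℝ` represents it on differentials at `(0,0)`. -/
theorem queer_poisson_bracket_on_H_times_R
    {H : Type*} [NormedAddCommGroup H] [InnerProductSpace ℝ H] [CompleteSpace H]
    (hinf : ¬ FiniteDimensional ℝ H)
    (ℓ : (H →L[ℝ] H) →L[ℝ] ℝ)
    (hid : ℓ (ContinuousLinearMap.id ℝ H) = 1)
    (hcpt : ∀ K : H →L[ℝ] H, IsCompactOperator K → ℓ K = 0) :
    ¬ ∃ P : ((H × ℝ) →L[ℝ] ℝ) →L[ℝ] ((H × ℝ) →L[ℝ] ℝ) →L[ℝ] ℝ,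
      ∀ f g : H × ℝ → ℝ, ContDiff ℝ (⊤ : ℕ∞) f → ContDiff ℝ (⊤ : ℕ∞) g →
        deltaEll ℓ (fun u => f (u, 0)) 0 * deriv (fun t => g (0, t)) 0
          - deriv (fun t => f (0, t)) 0 * deltaEll ℓ (fun u => g (u, 0)) 0
        = P (fderiv ℝ f (0, 0)) (fderiv ℝ g (0, 0)) := by
  rintro ⟨P, hP⟩
  have h := hP (fun p => inner ℝ p.1 p.1) (fun p => p.2) (contDiff_fst.inner ℝ contDiff_fst) contDiff_snd
  have h1 : ∀ u : H, HasFDerivAt (fun u : H => inner ℝ u u) ((2 : ℝ) • innerSL ℝ u) u := by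
    intro u
    have := (hasFDerivAt_id u).inner ℝ (hasFDerivAt_id u)
    refine this.congr_fderiv ?_
    ext w
    simp [real_inner_comm, two_mul]
  have h2 : fderiv ℝ (fun u : H => (inner ℝ u u : ℝ)) = fun u => ((2 : ℝ) • innerSL ℝ : H →L[ℝ] H →L[ℝ] ℝ) u := by
    funext u
    rw [(h1 u).fderiv]
    rfl
  have h3 : fderiv ℝ (fun p : H × ℝ => (inner ℝ p.1 p.1 : ℝ)) (0, 0) = 0 := by
    have := (h1 (0 : H)).comp ((0 : H), (0 : ℝ)) (hasFDerivAt_fst (𝕜 := ℝ) (p := ((0 : H), (0 : ℝ))))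
    have e := this.fderiv
    simp only [map_zero, smul_zero, ContinuousLinearMap.zero_comp] at e
    exact e
  have h4 : bilinToOp ((2 : ℝ) • innerSL ℝ : H →L[ℝ] H →L[ℝ] ℝ) = (2 : ℝ) • ContinuousLinearMap.id ℝ H := by
    ext w
    apply (InnerProductSpace.toDual ℝ H).injective
    ext z
    simp [bilinToOp]
    rfl
  have h5 : deltaEll ℓ (fun u : H => (inner ℝ u u : ℝ)) 0 = 2 := by
    unfold deltaEll
    rw [h2, ContinuousLinearMap.fderiv, h4, map_smul, hid]
    simp
  rw [h3] at h
  simp [-inner_self_eq_norm_sq_to_K, h5] at h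
end

section
/- Let 1 ≤ p ≤ 2 and let ℓ^p denote the real Banach space of p-summable real sequences. The bilinear form B(v,w) := Σ_{n} vₙwₙ is well defined and bounded on ℓ^p × ℓ^p, and B does not belong to the closure, in the Banach space L₂(ℓ^p;ℝ) of bounded bilinear forms with the operator norm, of the linear span of the elementary tensors f⊗g with f,g ∈ (ℓ^p)*. -/
open scoped ENNReal

/-- For `1 ≤ p ≤ 2`, the bilinear form `B(v,w) = Σₙ vₙwₙ` is well defined and
bounded on `ℓ^p × ℓ^p`, and `B` does not belong to the operator-norm closure of
the linear span of the elementary tensors `f ⊗ g`, `f, g ∈ (ℓ^p)*`, inside the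
space of bounded bilinear forms on `ℓ^p`. -/
theorem pairing_form_not_in_closure_of_span_of_tensors
    (p : ℝ≥0∞) [Fact (1 ≤ p)] (hp : p ≤ 2) :
    (∀ v w : lp (fun _ : ℕ => ℝ) p, Summable (fun n => v n * w n)) ∧
    ∃ B : (lp (fun _ : ℕ => ℝ) p) →L[ℝ] (lp (fun _ : ℕ => ℝ) p) →L[ℝ] ℝ,
      (∀ v w : lp (fun _ : ℕ => ℝ) p, B v w = ∑' n, v n * w n) ∧
      B ∉ closure ((Submodule.span ℝ
          {T : (lp (fun _ : ℕ => ℝ) p) →L[ℝ] (lp (fun _ : ℕ => ℝ) p) →L[ℝ] ℝ |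
            ∃ f g : (lp (fun _ : ℕ => ℝ) p) →L[ℝ] ℝ, T = f.smulRight g} :
          Submodule ℝ _) :
        Set ((lp (fun _ : ℕ => ℝ) p) →L[ℝ] (lp (fun _ : ℕ => ℝ) p) →L[ℝ] ℝ)) := by
  have hp0 : 0 < p := zero_lt_one.trans_le Fact.out
  let J : lp (fun _ : ℕ => ℝ) p →L[ℝ] lp (fun _ : ℕ => ℝ) 2 :=
    ContinuousLinearMap.ofSeqClosedGraph (g := lp.linearMapOfLE ℝ (fun _ : ℕ => ℝ) hp) (by
      intro u x y hu hy
      ext i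
      have h1 := ((lp.evalCLM ℝ (fun _ : ℕ => ℝ) p i).continuous.tendsto x).comp hu
      have h2 := ((lp.evalCLM ℝ (fun _ : ℕ => ℝ) 2 i).continuous.tendsto y).comp hy
      exact tendsto_nhds_unique h2 h1)
  have hJ : ∀ v i, J v i = v i := fun v i => rfl
  have hsum : ∀ v w : lp (fun _ : ℕ => ℝ) p, HasSum (fun n => v n * w n) (inner ℝ (J v) (J w)) := by
    intro v w
    have h := lp.hasSum_inner (𝕜 := ℝ) (J v) (J w)
    simpa [hJ, mul_comm] using h
  obtain ⟨B, hBv⟩ : ∃ B : (lp (fun _ : ℕ => ℝ) p) →L[ℝ] (lp (fun _ : ℕ => ℝ) p) →L[ℝ] ℝ,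
      ∀ v w, B v w = inner ℝ (J v) (J w) := ⟨(innerSL ℝ).bilinearComp J J, fun _ _ => rfl⟩
  refine ⟨fun v w => (hsum v w).summable, B, ?_, ?_⟩
  · intro v w
    rw [(hsum v w).tsum_eq]
    exact hBv v w
  intro hB
  have hcl := isClosed_setOfPred_isCompactOperator (σ₁₂ := RingHom.id ℝ)
    (M₁ := lp (fun _ : ℕ => ℝ) p) (M₂ := lp (fun _ : ℕ => ℝ) p →L[ℝ] ℝ)
  have hle : Submodule.span ℝ
          {T : (lp (fun _ : ℕ => ℝ) p) →L[ℝ] (lp (fun _ : ℕ => ℝ) p) →L[ℝ] ℝ |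
            ∃ f g : (lp (fun _ : ℕ => ℝ) p) →L[ℝ] ℝ, T = f.smulRight g} ≤
      compactOperator (RingHom.id ℝ) _ _ := by
    rw [Submodule.span_le]
    rintro T ⟨f, g, rfl⟩
    exact (isCompactOperator_of_locallyCompactSpace_dom f).clm_comp
      (ContinuousLinearMap.toSpanSingleton ℝ g)
  have hc : IsCompactOperator B := closure_minimal (SetLike.coe_subset_coe.2 hle) hcl hB
  obtain ⟨K, hK, hKB⟩ := IsCompactOperator.image_closedBall_subset_compact
    (f := B.toLinearMap) hc 1
  let e : ℕ → lp (fun _ : ℕ => ℝ) p := fun n => lp.single p n (1 : ℝ)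
  have hen : ∀ n, ‖e n‖ = 1 := fun n => by simp [e, lp.norm_single hp0]
  have hBe : ∀ m n, B (e m) (e n) = if m = n then 1 else 0 := by
    intro m n
    have h := hsum (e m) (e n)
    have h2 : B (e m) (e n) = inner ℝ (J (e m)) (J (e n)) := hBv _ _
    rw [h2, ← h.tsum_eq, tsum_eq_single n]
    · simp [e, Pi.single_apply, eq_comm]
    · intro k hk
      simp [e, Pi.single_apply, hk]
  obtain ⟨a, -, φ, hφ, hlim⟩ := hK.tendsto_subseq (x := fun n => B (e n))
    (fun n => hKB ⟨e n, by simp [hen], rfl⟩)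
  obtain ⟨N, hN⟩ := Metric.cauchySeq_iff'.1 hlim.cauchySeq 1 one_pos
  have h := hN (N+1) (Nat.le_succ N)
  have hne : φ (N+1) ≠ φ N := fun h => by simpa using hφ.injective h
  rw [dist_eq_norm] at h
  have h3 := (B (e (φ (N+1))) - B (e (φ N))).le_opNorm (e (φ N))
  rw [ContinuousLinearMap.sub_apply, hBe, hBe, hen] at h3
  simp [hne] at h3
  simp only [Function.comp] at h
  linarith
end
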